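/- arXiv:math/0702028 — 2 statements merged into one kernel-verified Lean document; each statement's English description precedes it below -/
import Mathlib

section
/- Let M be a nonzero uniformly finite R-module, N a submodule with N ≠ M, and U₁, ..., Uₙ uniform submodules of M/N such that the sum U₁ + ⋯ + Uₙ is direct and essential in M/N. For each i, let C̄_i be a complement to U_i in M/N containing all U_j with j ≠ i, and let C_i = π⁻¹(C̄_i), where π : M → M/N is the canonical projection. Then: (1) the canonical image of U_i in M/C_i is an essential submodule of M/C_i, and hence C_i is a [U_i]-primary submodule of M; (2) N = C₁ ∩ ⋯ ∩ Cₙ is a shortest uniform decomposition of N in M; in particular, N = C₁ ∩ ⋯ ∩ Cₙ is an irredundant primary decomposition of N in M. -/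
/-!
Definitions following Bavula, "Primary decompositions for left Noetherian rings".
All modules are left modules over an associative ring `R` with 1.
-/

universe u v

section Defs

variable (R : Type u) [Ring R]

/-- `N` is an essential submodule of the module `A`:
it intersects every nonzero submodule of `A` nontrivially. -/
def EssentialSub {A : Type v} [AddCommGroup A] [Module R A] (N : Submodule R A) : Prop :=
  ∀ L : Submodule R A, L ≠ ⊥ → N ⊓ L ≠ ⊥

/-- A module `A` is uniform: it is nonzero and every nonzero submodule is essential. -/
def UniformMod (A : Type v) [AddCommGroup A] [Module R A] : Prop :=
  Nontrivial A ∧ ∀ V : Submodule R A, V ≠ ⊥ → EssentialSub R V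

/-- A submodule is uniform if it is uniform as a module. -/
def UniformSub {A : Type v} [AddCommGroup A] [Module R A] (U : Submodule R A) : Prop :=
  UniformMod R ↥U

/-- `A` has finite uniform dimension:
it contains no infinite direct sum of nonzero submodules. -/
def FinUdim (A : Type v) [AddCommGroup A] [Module R A] : Prop :=
  ¬ ∃ f : ℕ → Submodule R A, (∀ n, f n ≠ ⊥) ∧ iSupIndep f

/-- `A` has uniform dimension `n`: there is an essential direct sum of `n`
uniform submodules of `A`. -/
def UdimEq (A : Type v) [AddCommGroup A] [Module R A] (n : ℕ) : Prop :=
  ∃ U : Fin n → Submodule R A, (∀ i, UniformSub R (U i)) ∧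
    iSupIndep U ∧ EssentialSub R (⨆ i, U i)

/-- Essential equivalence of modules: they possess isomorphic essential submodules. -/
def EssEquiv (A B : ModuleCat.{v} R) : Prop :=
  ∃ (L₁ : Submodule R A) (L₂ : Submodule R B),
    EssentialSub R L₁ ∧ EssentialSub R L₂ ∧ Nonempty (L₁ ≃ₗ[R] L₂)

/-- The left spectrum-style quotient: classes `[A]` of modules under essential
equivalence (for uniform modules these classes are the left primes). -/
def LeftSpec := Quot (EssEquiv R)

/-- The class `[A]` of the module `A` under essential equivalence. -/
def leftPrime (A : Type v) [AddCommGroup A] [Module R A] : LeftSpec.{u, v} R :=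
  Quot.mk _ (ModuleCat.of R A)

/-- The set `As_R(A)` of associated left primes of `A`:
the classes of the uniform submodules of `A`. -/
def leftAss (A : Type v) [AddCommGroup A] [Module R A] : Set (LeftSpec.{u, v} R) :=
  { x | ∃ U : Submodule R A, UniformSub R U ∧ x = leftPrime R ↥U }

/-- `A` is uniformly finite: every factor module of `A` has finite uniform dimension. -/
def UniformlyFinite (A : Type v) [AddCommGroup A] [Module R A] : Prop :=
  ∀ N : Submodule R A, FinUdim R (A ⧸ N)

/-- `N` is an `X`-primary submodule of `A`: `A/N` has finite uniform dimension and
`As_R(A/N) = {X}`. -/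
def PrimarySub {A : Type v} [AddCommGroup A] [Module R A] (N : Submodule R A)
    (X : LeftSpec.{u, v} R) : Prop :=
  FinUdim R (A ⧸ N) ∧ leftAss R (A ⧸ N) = {X}

/-- `Ns` is a primary decomposition of `N` in `A`. -/
def IsPrimaryDecomp {A : Type v} [AddCommGroup A] [Module R A] (N : Submodule R A)
    (s : ℕ) (Ns : Fin s → Submodule R A) : Prop :=
  N = ⨅ i, Ns i ∧ ∀ i, ∃ X, PrimarySub R (Ns i) X

/-- `Ns` is a shortest primary decomposition of `N` in `A`:
no primary decomposition of `N` in `A` has fewer terms. -/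
def IsShortestPrimaryDecomp {A : Type v} [AddCommGroup A] [Module R A] (N : Submodule R A)
    (s : ℕ) (Ns : Fin s → Submodule R A) : Prop :=
  IsPrimaryDecomp R N s Ns ∧
    ∀ (t : ℕ) (Ls : Fin t → Submodule R A), IsPrimaryDecomp R N t Ls → s ≤ t

/-- `C` is a complement to `W` in the ambient module: `W ⊓ C = ⊥` and `C` is maximal
with this property. -/
def IsComplementTo {A : Type v} [AddCommGroup A] [Module R A] (C W : Submodule R A) : Prop :=
  W ⊓ C = ⊥ ∧ ∀ D : Submodule R A, C ≤ D → W ⊓ D = ⊥ → D = C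

/-- A proper submodule `N ⊊ A` is irreducible if it is not the intersection of two
strictly larger submodules. -/
def IrreducibleSub {A : Type v} [AddCommGroup A] [Module R A] (N : Submodule R A) : Prop :=
  N ≠ ⊤ ∧ ¬ ∃ P Q : Submodule R A, N < P ∧ N < Q ∧ N = P ⊓ Q

/-- The multiplicity of the left prime `x` in `A` is `m`: in some (equivalently, any)
essential direct sum of uniform submodules of `A`, exactly `m` summands lie in class `x`. -/
def HasMult (A : Type v) [AddCommGroup A] [Module R A] (x : LeftSpec.{u, v} R) (m : ℕ) : Prop :=
  ∃ (n : ℕ) (U : Fin n → Submodule R A), (∀ i, UniformSub R (U i)) ∧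
    iSupIndep U ∧ EssentialSub R (⨆ i, U i) ∧
    m = Nat.card {i : Fin n // leftPrime R ↥(U i) = x}

end Defs
section Complements

variable {R : Type u} [Ring R] {P Q : Type v} [AddCommGroup P] [Module R P]
  [AddCommGroup Q] [Module R Q]

theorem comap_subtype_eq_bot_iff (U D : Submodule R P) : D.comap U.subtype = ⊥ ↔ U ⊓ D = ⊥ := by
  rw [← disjoint_iff, Submodule.disjoint_iff_comap_eq_bot]

theorem UniformSub.ne_bot {U : Submodule R P} (hU : UniformSub R U) : U ≠ ⊥ :=
  (Submodule.nontrivial_iff_ne_bot).1 hU.1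

theorem UniformMod.uniformSub {V : Submodule R P} (hP : UniformMod R P) (hV : V ≠ ⊥) :
    UniformSub R V := by
  refine ⟨Submodule.nontrivial_iff_ne_bot.2 hV, fun A hA B hB hAB => ?_⟩
  have inj := V.injective_subtype
  refine hP.2 (A.map V.subtype) ?_ (B.map V.subtype) ?_ ?_
  · rwa [Ne, ← LinearMap.le_ker_iff_map, Submodule.ker_subtype, le_bot_iff]
  · rwa [Ne, ← LinearMap.le_ker_iff_map, Submodule.ker_subtype, le_bot_iff]
  · rw [← Submodule.map_inf _ inj, hAB, Submodule.map_bot]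

theorem UniformSub.inf_ne_bot {U A B : Submodule R P} (hU : UniformSub R U)
    (hA : U ⊓ A ≠ ⊥) (hB : U ⊓ B ≠ ⊥) : U ⊓ (A ⊓ B) ≠ ⊥ := by
  have h := hU.2 (A.comap U.subtype) (mt (comap_subtype_eq_bot_iff U A).1 hA)
    (B.comap U.subtype) (mt (comap_subtype_eq_bot_iff U B).1 hB)
  rw [← Submodule.comap_inf] at h
  exact mt (comap_subtype_eq_bot_iff U _).2 h

/-- If the kernel of a surjection is a complement to `U`, the pullback of every nonzero submodule
meets `U`. -/
theorem IsComplementTo.inf_comap_ne_bot {U : Submodule R P} {f : P →ₗ[R] Q}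
    (hf : Function.Surjective f) (hc : IsComplementTo R (LinearMap.ker f) U)
    {L : Submodule R Q} (hL : L ≠ ⊥) : U ⊓ L.comap f ≠ ⊥ := by
  intro h
  have h' := hc.2 _ (LinearMap.ker_le_comap (p := L) f) h
  apply hL
  rw [← Submodule.map_comap_eq_of_surjective hf L, h', ← LinearMap.le_ker_iff_map]

theorem IsComplementTo.map_ne_bot {C U A : Submodule R P} {f : P →ₗ[R] Q}
    (hC : LinearMap.ker f = C) (hc : IsComplementTo R C U) (hA : U ⊓ A ≠ ⊥) :
    (U ⊓ A).map f ≠ ⊥ := by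
  rw [Ne, ← LinearMap.le_ker_iff_map, hC]
  intro h
  exact hA (le_bot_iff.1 (hc.1 ▸ le_inf inf_le_left h))

theorem IsComplementTo.essentialSub_map {U : Submodule R P} {f : P →ₗ[R] Q}
    (hf : Function.Surjective f) (hc : IsComplementTo R (LinearMap.ker f) U) :
    EssentialSub R (U.map f) := fun L hL h => by
  apply hc.map_ne_bot rfl (hc.inf_comap_ne_bot hf hL)
  exact le_bot_iff.1 (h ▸ le_inf (Submodule.map_mono inf_le_left)
    (Submodule.map_le_iff_le_comap.2 inf_le_right))

theorem IsComplementTo.uniformMod {U : Submodule R P} {f : P →ₗ[R] Q}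
    (hf : Function.Surjective f) (hc : IsComplementTo R (LinearMap.ker f) U)
    (hU : UniformSub R U) : UniformMod R Q := by
  constructor
  · have h := hc.map_ne_bot (A := ⊤) rfl (by simpa using hU.ne_bot)
    obtain ⟨x, -, hx⟩ := Submodule.exists_mem_ne_zero_of_ne_bot h
    exact ⟨x, 0, hx⟩
  · intro V hV L hL h
    apply hc.map_ne_bot rfl
      (hU.inf_ne_bot (hc.inf_comap_ne_bot hf hV) (hc.inf_comap_ne_bot hf hL))
    rw [← le_bot_iff, ← h, ← Submodule.comap_inf]
    exact Submodule.map_le_iff_le_comap.2 inf_le_right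

theorem IsComplementTo.leftPrime_eq {U : Submodule R P} {f : P →ₗ[R] Q}
    (hf : Function.Surjective f) (hc : IsComplementTo R (LinearMap.ker f) U)
    (hU : UniformSub R U) {V : Submodule R Q} (hV : V ≠ ⊥) :
    leftPrime R V = leftPrime R U := by
  have hVu : UniformSub R V := (hc.uniformMod hf hU).uniformSub hV
  have hL₁ : (U.map f).comap V.subtype ≠ ⊥ := by
    rw [Ne, comap_subtype_eq_bot_iff, inf_comm]
    exact hc.essentialSub_map hf V hV
  have hL₂ : (V.comap f).comap U.subtype ≠ ⊥ := by
    rw [Ne, comap_subtype_eq_bot_iff]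
    exact hc.inf_comap_ne_bot hf hV
  let g : (V.comap f).comap U.subtype →ₗ[R] (U.map f).comap V.subtype :=
    { toFun := fun x => ⟨⟨f x.1.1, x.2⟩, ⟨x.1.1, x.1.2, rfl⟩⟩
      map_add' := fun x y => by ext; simp
      map_smul' := fun r x => by ext; simp }
  have hg : Function.Bijective g := by
    constructor
    · rw [← LinearMap.ker_eq_bot, LinearMap.ker_eq_bot']
      intro x hx
      have hfx : f x.1.1 = 0 := congrArg (fun y => y.1.1) hx
      have hm : x.1.1 ∈ U ⊓ LinearMap.ker f := ⟨x.1.2, hfx⟩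
      rw [hc.1, Submodule.mem_bot] at hm
      exact Subtype.ext (Subtype.ext hm)
    · rintro ⟨⟨y, hy⟩, x, hx, hxy : f x = y⟩
      subst hxy
      exact ⟨⟨⟨x, hx⟩, hy⟩, rfl⟩
  exact Quot.sound ⟨_, _, hVu.2 _ hL₁, hU.2 _ hL₂, ⟨(LinearEquiv.ofBijective g hg).symm⟩⟩

theorem IsComplementTo.leftAss_eq {U : Submodule R P} {f : P →ₗ[R] Q}
    (hf : Function.Surjective f) (hc : IsComplementTo R (LinearMap.ker f) U)
    (hU : UniformSub R U) : leftAss R Q = {leftPrime R U} := by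
  ext X
  constructor
  · rintro ⟨V, hV, rfl⟩
    exact hc.leftPrime_eq hf hU hV.ne_bot
  · rintro rfl
    have hQ := hc.uniformMod hf hU
    have := hQ.1
    exact ⟨⊤, hQ.uniformSub top_ne_bot, (hc.leftPrime_eq hf hU top_ne_bot).symm⟩

theorem iInf_eq_bot_of_isComplementTo {ι : Type*} {U C : ι → Submodule R P}
    (hUess : EssentialSub R (⨆ i, U i))
    (hC : ∀ i, (∀ j, j ≠ i → U j ≤ C i) ∧ IsComplementTo R (C i) (U i)) :
    ⨅ i, C i = ⊥ := by
  classical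
  by_contra hne
  refine hUess _ hne (le_bot_iff.1 ?_)
  rintro x ⟨hx, hxC⟩
  obtain ⟨u, hu, rfl⟩ := (Submodule.mem_iSup_iff_exists_finsupp U x).1 hx
  have hu0 : ∀ i, u i = 0 := by
    intro i
    by_cases hi : i ∈ u.support
    · have hs : u i + ∑ j ∈ u.support.erase i, u j = u.sum fun _ y => y :=
        Finset.add_sum_erase _ _ hi
      have h₁ : u.sum (fun _ y => y) ∈ C i := (Submodule.mem_iInf _).1 hxC i
      have h₂ : ∑ j ∈ u.support.erase i, u j ∈ C i :=
        Submodule.sum_mem _ fun j hj => (hC i).1 j (Finset.ne_of_mem_erase hj) (hu j)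
      have hm : u i ∈ U i ⊓ C i :=
        ⟨hu i, by rw [← hs] at h₁; exact (Submodule.add_mem_iff_left _ h₂).1 h₁⟩
      rwa [(hC i).2.1, Submodule.mem_bot] at hm
    · exact Finsupp.notMem_support_iff.1 hi
  exact Finset.sum_eq_zero fun i _ => hu0 i

end Complements

/-- Lemma `UiCipr`: let `N` be a proper submodule of a nonzero
uniformly finite module `M` and `U₁ ⊕ ⋯ ⊕ Uₙ` an essential direct sum of uniform
submodules of `M/N`; for each `i` let `C̄ᵢ` be a complement to `Uᵢ` in `M/N` containing
the `Uⱼ` (`j ≠ i`) and `Cᵢ = π⁻¹(C̄ᵢ)`. Then (1) the canonical image of `Uᵢ` in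
`M/Cᵢ ≅ (M/N)/C̄ᵢ` is essential, so `Cᵢ` is `[Uᵢ]`-primary; (2) `N = C₁ ∩ ⋯ ∩ Cₙ` is
a shortest uniform decomposition of `N` in `M`; in particular it is an irredundant
primary decomposition of `N` in `M`. -/
theorem shortest_uniformDecomposition_construction
    {R : Type u} [Ring R] {M : Type v} [AddCommGroup M] [Module R M]
    (hM : Nontrivial M) (huf : UniformlyFinite R M)
    (N : Submodule R M) (hN : N ≠ ⊤)
    (n : ℕ) (U : Fin n → Submodule R (M ⧸ N))
    (hU : ∀ i, UniformSub R (U i)) (hUind : iSupIndep U)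
    (hUess : EssentialSub R (⨆ i, U i))
    (Cb : Fin n → Submodule R (M ⧸ N))
    (hCb : ∀ i, (∀ j, j ≠ i → U j ≤ Cb i) ∧ IsComplementTo R (Cb i) (U i))
    (C : Fin n → Submodule R M)
    (hC : ∀ i, C i = Submodule.comap N.mkQ (Cb i)) :
    (∀ i, EssentialSub R (Submodule.map (Cb i).mkQ (U i)) ∧
      PrimarySub R (C i) (leftPrime R ↥(U i))) ∧
    N = ⨅ i, C i ∧
    (∀ i, UniformMod R (M ⧸ C i)) ∧
    UdimEq R (M ⧸ N) n ∧
    IsPrimaryDecomp R N n C ∧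
    (∀ i, (⨅ (j) (_ : j ≠ i), C j) ≠ N) := by
  have hNC : ∀ i, N ≤ C i := fun i => by
    rw [hC]
    simpa using LinearMap.ker_le_comap (p := Cb i) N.mkQ
  have hsurj : ∀ i, Function.Surjective (Submodule.factor (hNC i)) := fun i =>
    Submodule.factor_surjective (hNC i)
  have hker : ∀ i, LinearMap.ker (Submodule.factor (hNC i)) = Cb i := fun i => by
    ext x
    obtain ⟨x, rfl⟩ := N.mkQ_surjective x
    simp [hC]
  have hcomp : ∀ i, IsComplementTo R (LinearMap.ker (Submodule.factor (hNC i))) (U i) :=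
    fun i => (hker i).symm ▸ (hCb i).2
  have hprim : ∀ i, PrimarySub R (C i) (leftPrime R ↥(U i)) := fun i =>
    ⟨huf _, (hcomp i).leftAss_eq (hsurj i) (hU i)⟩
  have hinf : N = ⨅ i, C i := by
    have h := congrArg (Submodule.comap N.mkQ) (iInf_eq_bot_of_isComplementTo hUess hCb)
    rw [Submodule.comap_iInf, Submodule.comap_bot, Submodule.ker_mkQ] at h
    simpa only [hC] using h.symm
  refine ⟨fun i => ⟨?_, hprim i⟩, hinf, fun i => (hcomp i).uniformMod (hsurj i) (hU i),
    ⟨U, hU, hUind, hUess⟩, ⟨hinf, fun i => ⟨_, hprim i⟩⟩, fun i h => ?_⟩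
  · apply IsComplementTo.essentialSub_map (Cb i).mkQ_surjective
    rw [Submodule.ker_mkQ]
    exact (hCb i).2
  · have hle : (U i).comap N.mkQ ≤ N := by
      refine le_of_le_of_eq (le_iInf₂ fun j hj => ?_) h
      rw [hC]
      exact Submodule.comap_mono ((hCb j).1 i hj.symm)
    apply (hU i).ne_bot
    rw [← Submodule.map_comap_eq_of_surjective N.mkQ_surjective (U i), ← LinearMap.le_ker_iff_map,
      Submodule.ker_mkQ]
    exact hle
end

section
/- Let M be a nonzero uniformly finite R-module, N a submodule with N ≠ M, and N = N₁ ∩ ⋯ ∩ Nₙ a shortest uniform decomposition of N in M. Then: (1) M/N contains uniform submodules U₁, ..., Uₙ whose sum U₁ + ⋯ + Uₙ is direct, with As_R(M/N_i) = {[U_i]} for each i; (2) for each i there exists a complement C_i to U_i in M/N containing Σ_{j≠i} U_j such that Σ_{j≠i} U_j ⊆ N_i/N ⊆ C_i. Conversely, given any uniform submodules U₁', ..., Uₙ' of M/N whose sum is direct (note n = u.dim(M/N)), any complements C_i' to U_i' in M/N containing Σ_{j≠i} U_j', and any submodules N_i' of M containing N such that M/N_i' is uniform and Σ_{j≠i}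 U_j' ⊆ N_i'/N ⊆ C_i', one has that N = N₁' ∩ ⋯ ∩ Nₙ' is a shortest uniform decomposition of N in M; moreover every shortest uniform decomposition of N in M arises in this way. -/
/-!
Definitions following Bavula, "Primary decompositions for left Noetherian rings".
All modules are left modules over an associative ring `R` with 1.
-/

universe u v

section Uniform

variable {R : Type u} [Ring R] {A : Type v} [AddCommGroup A] [Module R A]

theorem UniformMod.infIrred_of_quotient {Q : Submodule R A} (h : UniformMod R (A ⧸ Q)) :
    InfIrred Q := by
  obtain ⟨hnt, hess⟩ := h
  have map_ne_bot {b : Submodule R A} (hQb : Q ≤ b) (hb : b ≠ Q) : b.map Q.mkQ ≠ ⊥ := by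
    intro h0
    rw [← le_bot_iff, Submodule.map_le_iff_le_comap, Submodule.comap_bot, Submodule.ker_mkQ] at h0
    exact hb (le_antisymm h0 hQb)
  refine ⟨fun hmax => Submodule.Quotient.nontrivial_iff.1 hnt (isMax_iff_eq_top.1 hmax), ?_⟩
  rintro b c hbc
  by_contra! hne
  have hQb : Q ≤ b := hbc ▸ inf_le_left
  have hQc : Q ≤ c := hbc ▸ inf_le_right
  refine hess _ (map_ne_bot hQb hne.1) _ (map_ne_bot hQc hne.2) ?_
  refine Submodule.comap_injective_of_surjective Q.mkQ_surjective ?_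
  rw [Submodule.comap_inf, Submodule.comap_map_mkQ, Submodule.comap_map_mkQ,
    sup_eq_right.2 hQb, sup_eq_right.2 hQc, hbc, Submodule.comap_bot, Submodule.ker_mkQ]

theorem InfIrred.map_mkQ {N Q : Submodule R A} (hQ : InfIrred Q) (hNQ : N ≤ Q) :
    InfIrred (Q.map N.mkQ) := by
  have hcm : (Q.map N.mkQ).comap N.mkQ = Q := by
    rw [Submodule.comap_map_mkQ, sup_eq_right.2 hNQ]
  refine ⟨fun hmax => hQ.1 ?_, fun b c hbc => ?_⟩
  · rw [isMax_iff_eq_top] at hmax ⊢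
    rw [← hcm, hmax, Submodule.comap_top]
  · have hinj := Submodule.comap_injective_of_surjective N.mkQ_surjective
    have key : b.comap N.mkQ ⊓ c.comap N.mkQ = Q := by
      rw [← Submodule.comap_inf, hbc, hcm]
    exact (hQ.2 key).imp (fun h => hinj (h.trans hcm.symm)) fun h => hinj (h.trans hcm.symm)

theorem UniformMod.of_injective {X B : Type v} [AddCommGroup X] [Module R X] [AddCommGroup B]
    [Module R B] [Nontrivial X] (hB : UniformMod R B) (g : X →ₗ[R] B)
    (hg : Function.Injective g) : UniformMod R X := by
  refine ⟨‹_›, fun V hV L hL h0 => ?_⟩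
  have map_ne_bot {W : Submodule R X} (hW : W ≠ ⊥) : W.map g ≠ ⊥ :=
    fun h => hW (Submodule.map_injective_of_injective hg (h.trans (Submodule.map_bot g).symm))
  apply hB.2 _ (map_ne_bot hV) _ (map_ne_bot hL)
  rw [← Submodule.map_inf g hg, h0, Submodule.map_bot]

/-- Nonzero submodules of a uniform module all have the same class. -/
theorem leftPrime_eq_of_injective {X Y B : Type v} [AddCommGroup X] [Module R X]
    [AddCommGroup Y] [Module R Y] [AddCommGroup B] [Module R B] [Nontrivial X] [Nontrivial Y]
    (hB : UniformMod R B) {f : X →ₗ[R] B} {g : Y →ₗ[R] B}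
    (hf : Function.Injective f) (hg : Function.Injective g) :
    leftPrime R X = leftPrime R Y := by
  have range_ne_bot {Z : Type v} [AddCommGroup Z] [Module R Z] [Nontrivial Z] {k : Z →ₗ[R] B}
      (hk : Function.Injective k) : LinearMap.range k ≠ ⊥ := by
    rw [LinearMap.range_eq_map, ← Submodule.map_bot k]
    exact (Submodule.map_injective_of_injective hk).ne top_ne_bot
  have hinf := hB.2 _ (range_ne_bot hf) _ (range_ne_bot hg)
  have hfm : ((LinearMap.range g).comap f).map f = LinearMap.range f ⊓ LinearMap.range g :=
    Submodule.map_comap_eq ..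
  have hgm : ((LinearMap.range f).comap g).map g = LinearMap.range f ⊓ LinearMap.range g :=
    (Submodule.map_comap_eq ..).trans (inf_comm _ _)
  refine Quot.sound ⟨(LinearMap.range g).comap f, (LinearMap.range f).comap g,
    (hB.of_injective f hf).2 _ fun h => hinf ?_, (hB.of_injective g hg).2 _ fun h => hinf ?_,
    ⟨(Submodule.equivMapOfInjective f hf _).trans
      ((LinearEquiv.ofEq _ _ (hfm.trans hgm.symm)).trans
        (Submodule.equivMapOfInjective g hg _).symm)⟩⟩
  · rw [← hfm, h, Submodule.map_bot]
  · rw [← hgm, h, Submodule.map_bot]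

theorem UniformMod.leftAss_eq_singleton {X B : Type v} [AddCommGroup X] [Module R X]
    [AddCommGroup B] [Module R B] [Nontrivial X] (hB : UniformMod R B) (g : X →ₗ[R] B)
    (hg : Function.Injective g) : leftAss R B = {leftPrime R X} := by
  ext x
  simp only [leftAss, Set.mem_ofPred_eq, Set.mem_singleton_iff]
  constructor
  · rintro ⟨W, hW, rfl⟩
    have := hW.1
    exact leftPrime_eq_of_injective hB W.injective_subtype hg
  · rintro rfl
    have : Nontrivial (LinearMap.range g) := (LinearEquiv.ofInjective g hg).symm.nontrivial
    exact ⟨LinearMap.range g, hB.of_injective _ (Submodule.injective_subtype _),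
      leftPrime_eq_of_injective hB hg (Submodule.injective_subtype _)⟩

theorem exists_isComplementTo {W P : Submodule R A} (h : Disjoint W P) :
    ∃ C : Submodule R A, P ≤ C ∧ IsComplementTo R C W := by
  obtain ⟨C, hPC, hC⟩ := zorn_le_nonempty₀ {D : Submodule R A | Disjoint W D}
    (fun c hc hchain y hy => ⟨sSup c,
      hchain.directedOn.disjoint_sSup_right.2 fun D hD => hc hD, fun z hz => le_sSup hz⟩) P h
  exact ⟨C, hPC, hC.1.eq_bot, fun D hCD hD =>
    le_antisymm (hC.2 (disjoint_iff.2 hD) hCD) hCD⟩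

theorem inf_sup_ne_bot_of_infIrred {P V W : Submodule R A} (hP : InfIrred P)
    (hV : V ≠ ⊥) (hVW : Disjoint V W) (hWP : ¬ W ≤ P) : (V ⊔ W) ⊓ P ≠ ⊥ := by
  intro h0
  have hVP : ¬ V ≤ P := fun hle => hV <| eq_bot_iff.2 <| h0 ▸ le_inf le_sup_left hle
  have hne : (P ⊔ V) ⊓ (P ⊔ W) ≠ P := fun h =>
    (hP.2 h).elim (fun h => hVP (h ▸ le_sup_right)) fun h => hWP (h ▸ le_sup_right)
  refine hne (le_antisymm ?_ (le_inf le_sup_left le_sup_left))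
  rintro x ⟨hx1, hx2⟩
  obtain ⟨p, hp, v, hv, rfl⟩ := Submodule.mem_sup.1 hx1
  obtain ⟨q, hq, w, hw, hqw⟩ := Submodule.mem_sup.1 hx2
  have hmem : v - w ∈ (V ⊔ W) ⊓ P := by
    refine ⟨sub_mem (Submodule.mem_sup_left hv) (Submodule.mem_sup_right hw), ?_⟩
    have : v - w = q - p := by rw [sub_eq_sub_iff_add_eq_add, add_comm v p, ← hqw]
    exact this ▸ sub_mem hq hp
  rw [h0, Submodule.mem_bot, sub_eq_zero] at hmem
  have hv0 : v = 0 := Submodule.disjoint_def.1 hVW v hv (hmem ▸ hw)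
  simpa [hv0] using hp

/-- Intersecting with a meet-irreducible submodule costs at most one independent summand. -/
theorem exists_iSupIndep_le_of_infIrred {P Q : Submodule R A} (hP : InfIrred P) {k : ℕ}
    {V : Fin (k + 1) → Submodule R A} (hne : ∀ i, V i ≠ ⊥) (hind : iSupIndep V)
    (hQ : ∀ i, V i ≤ Q) :
    ∃ W : Fin k → Submodule R A, (∀ i, W i ≠ ⊥) ∧ iSupIndep W ∧ ∀ i, W i ≤ P ⊓ Q := by
  by_cases h : ∀ i, V i ⊓ P ≠ ⊥
  · exact ⟨fun j => V j.castSucc ⊓ P, fun j => h _,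
      (hind.comp (Fin.castSucc_injective k)).mono fun j => inf_le_left,
      fun j => le_inf inf_le_right (inf_le_left.trans (hQ _))⟩
  push Not at h
  obtain ⟨a, ha⟩ := h
  have hVa : ¬ V a ≤ P := fun hle => hne a (by rwa [inf_eq_left.2 hle] at ha)
  refine ⟨fun j => (V (a.succAbove j) ⊔ V a) ⊓ P,
    fun j => inf_sup_ne_bot_of_infIrred hP (hne _)
      (hind.pairwiseDisjoint (Fin.succAbove_ne a j)) hVa,
    fun j => ?_, fun j => le_inf inf_le_right (inf_le_left.trans (sup_le (hQ _) (hQ _)))⟩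
  set S : Submodule R A := ⨆ (i) (_ : i ≠ a.succAbove j), V i
  have haS : V a ≤ S := le_iSup₂_of_le a (Fin.succAbove_ne a j).symm le_rfl
  have hrest : (⨆ (i) (_ : i ≠ j), (V (a.succAbove i) ⊔ V a) ⊓ P) ≤ S ⊓ P :=
    iSup₂_le fun i hi => inf_le_inf_right _ <| sup_le
      (le_iSup₂_of_le (a.succAbove i) (fun h => hi (Fin.succAbove_right_injective h)) le_rfl) haS
  refine disjoint_iff_inf_le.2 ((inf_le_inf_left _ hrest).trans ?_)
  calc (V (a.succAbove j) ⊔ V a) ⊓ P ⊓ (S ⊓ P)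
      ≤ (V a ⊔ V (a.succAbove j)) ⊓ S ⊓ P :=
        le_inf (le_inf (inf_le_left.trans (inf_le_left.trans (sup_comm _ _).le))
          (inf_le_right.trans inf_le_left)) (inf_le_right.trans inf_le_right)
    _ = (V a ⊔ V (a.succAbove j) ⊓ S) ⊓ P := by rw [sup_inf_assoc_of_le _ haS]
    _ = ⊥ := by rw [(hind (a.succAbove j)).eq_bot, sup_bot_eq, ha]

theorem exists_iSupIndep_le_iInf_of_infIrred {ι : Type*} {P : ι → Submodule R A}
    (hP : ∀ i, InfIrred (P i)) (S : Finset ι) {k : ℕ} {V : Fin (k + S.card) → Submodule R A}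
    (hne : ∀ i, V i ≠ ⊥) (hind : iSupIndep V) :
    ∃ W : Fin k → Submodule R A, (∀ i, W i ≠ ⊥) ∧ iSupIndep W ∧
      ∀ i, W i ≤ ⨅ j ∈ S, P j := by
  classical
  induction S using Finset.induction_on generalizing k with
  | empty => exact ⟨V, hne, hind, by simp⟩
  | insert a S ha ih =>
    have hcard : k + 1 + S.card = k + (insert a S).card := by
      rw [Finset.card_insert_of_notMem ha]; omega
    obtain ⟨V', hne', hind', hle'⟩ := ih (k := k + 1) (V := V ∘ Fin.cast hcard)
      (fun i => hne _) (hind.comp (Fin.cast_injective hcard))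
    simpa only [Finset.iInf_insert] using
      exists_iSupIndep_le_of_infIrred (hP a) hne' hind' hle'

theorem iInf_ne_bot_of_card_lt {ι : Type*} {P : ι → Submodule R A}
    (hP : ∀ i, InfIrred (P i)) (S : Finset ι) {n : ℕ} (hn : S.card < n)
    {V : Fin n → Submodule R A} (hne : ∀ i, V i ≠ ⊥) (hind : iSupIndep V) :
    ⨅ j ∈ S, P j ≠ ⊥ := by
  obtain ⟨k, rfl⟩ : ∃ k, n = k + 1 + S.card := ⟨n - 1 - S.card, by omega⟩
  obtain ⟨W, hW, -, hle⟩ := exists_iSupIndep_le_iInf_of_infIrred hP S hne hind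
  exact fun h0 => hW 0 (eq_bot_iff.2 (h0 ▸ hle 0))

theorem iSupIndep_fin_cons {n : ℕ} {V : Fin n → Submodule R A} {K : Submodule R A}
    (hind : iSupIndep V) (hK : Disjoint K (⨆ i, V i)) :
    iSupIndep (Fin.cons K V : Fin (n + 1) → Submodule R A) := by
  intro i
  induction i using Fin.cases with
  | zero =>
    refine hK.mono_right (iSup₂_le fun j hj => ?_)
    obtain ⟨j, rfl⟩ := Fin.exists_succ_eq.2 hj
    exact le_iSup V j
  | succ i =>
    have hd : Disjoint (V i) ((⨆ (j) (_ : j ≠ i), V j) ⊔ K) :=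
      (hind i).disjoint_sup_right_of_disjoint_sup_left <|
        hK.symm.mono_left (sup_le (le_iSup V i) (iSup₂_le fun j _ => le_iSup V j))
    refine hd.mono_right (iSup₂_le fun j hj => ?_)
    induction j using Fin.cases with
    | zero => exact le_sup_right
    | succ j =>
      exact le_sup_of_le_left (le_iSup₂_of_le j (fun h => hj (h ▸ rfl)) le_rfl)

theorem disjoint_iInf_iSup {ι : Type*} [Fintype ι] {P U : ι → Submodule R A}
    (hdisj : ∀ i, Disjoint (U i) (P i)) (hle : ∀ i j, j ≠ i → U j ≤ P i) :
    Disjoint (⨅ i, P i) (⨆ i, U i) := by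
  classical
  rw [Submodule.disjoint_def]
  intro x hxP hxU
  obtain ⟨u, hu, rfl⟩ := (Submodule.mem_iSup_iff_exists_finsupp _ _).1 hxU
  rw [Submodule.mem_iInf] at hxP
  rw [Finsupp.sum_fintype _ _ fun _ => rfl] at hxP ⊢
  refine Finset.sum_eq_zero fun i _ => Submodule.disjoint_def.1 (hdisj i) _ (hu i) ?_
  have hrest : ∑ j ∈ Finset.univ.erase i, u j ∈ P i :=
    sum_mem fun j hj => hle i j (Finset.ne_of_mem_erase hj) (hu j)
  have hi := hxP i
  rw [← Finset.add_sum_erase _ _ (Finset.mem_univ i)] at hi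
  exact (Submodule.add_mem_iff_left _ hrest).1 hi

theorem iInf_map_mkQ_eq_bot_iff {ι : Sort*} {N : Submodule R A} {Q : ι → Submodule R A}
    (hNQ : ∀ i, N ≤ Q i) : ⨅ i, (Q i).map N.mkQ = ⊥ ↔ N = ⨅ i, Q i := by
  rw [← (Submodule.comap_injective_of_surjective N.mkQ_surjective).eq_iff, Submodule.comap_iInf,
    Submodule.comap_bot, Submodule.ker_mkQ, eq_comm]
  simp only [Submodule.comap_map_mkQ, sup_eq_right.2 (hNQ _)]

theorem injective_mapQ_comp_subtype {N Q : Submodule R A} (hNQ : N ≤ Q)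
    {U : Submodule R (A ⧸ N)} (hU : Disjoint U (Q.map N.mkQ)) :
    Function.Injective ((Submodule.factor hNQ).comp U.subtype) := by
  rw [← LinearMap.ker_eq_bot, eq_bot_iff]
  rintro ⟨x, hxU⟩ hx
  obtain ⟨y, rfl⟩ := N.mkQ_surjective x
  have hy : y ∈ Q := by simpa using hx
  simpa using Submodule.disjoint_def.1 hU _ hxU (Submodule.mem_map_of_mem hy)

end Uniform

/-- Theorem `clstunid`, description of shortest uniform
decompositions: let `N = N₁ ∩ ⋯ ∩ Nₙ` be a shortest uniform decomposition of a
proper submodule `N` of a nonzero uniformly finite module `M` (each `M/Nᵢ` is uniform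
and `n = u.dim(M/N)`). Then (1) `M/N` contains uniform submodules `U₁, …, Uₙ` whose
sum is direct with `As_R(M/Nᵢ) = {[Uᵢ]}`, and (2) complements `Cᵢ` to `Uᵢ` containing
`Σ_{j≠i} Uⱼ` with `Σ_{j≠i} Uⱼ ⊆ Nᵢ/N ⊆ Cᵢ`. Conversely, any data `U'`, `C'`, `N'` as
in the statement yields a shortest uniform decomposition `N = N₁' ∩ ⋯ ∩ Nₙ'`; every
shortest uniform decomposition of `N` arises this way. -/
theorem shortest_uniformDecomposition_description
    {R : Type u} [Ring R] {M : Type v} [AddCommGroup M] [Module R M]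
    (hM : Nontrivial M) (huf : UniformlyFinite R M)
    (N : Submodule R M) (hN : N ≠ ⊤)
    (n : ℕ) (Ns : Fin n → Submodule R M)
    (hdec : N = ⨅ i, Ns i) (huni : ∀ i, UniformMod R (M ⧸ Ns i))
    (hshort : UdimEq R (M ⧸ N) n) :
    (∃ U : Fin n → Submodule R (M ⧸ N),
      (∀ i, UniformSub R (U i)) ∧ iSupIndep U ∧
      (∀ i, leftAss R (M ⧸ Ns i) = {leftPrime R ↥(U i)}) ∧
      ∃ C : Fin n → Submodule R (M ⧸ N),
        ∀ i, (∀ j, j ≠ i → U j ≤ C i) ∧ IsComplementTo R (C i) (U i) ∧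
          (⨆ (j) (_ : j ≠ i), U j) ≤ Submodule.map N.mkQ (Ns i) ∧
          Submodule.map N.mkQ (Ns i) ≤ C i) ∧
    (∀ U' : Fin n → Submodule R (M ⧸ N),
      (∀ i, UniformSub R (U' i)) → iSupIndep U' →
      ∀ C' : Fin n → Submodule R (M ⧸ N),
        (∀ i, (∀ j, j ≠ i → U' j ≤ C' i) ∧ IsComplementTo R (C' i) (U' i)) →
      ∀ N' : Fin n → Submodule R M,
        (∀ i, N ≤ N' i) → (∀ i, UniformMod R (M ⧸ N' i)) →
        (∀ i, (⨆ (j) (_ : j ≠ i), U' j) ≤ Submodule.map N.mkQ (N' i) ∧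
              Submodule.map N.mkQ (N' i) ≤ C' i) →
        N = ⨅ i, N' i) := by
  classical
  have hNle (i : Fin n) : N ≤ Ns i := hdec.trans_le (iInf_le Ns i)
  set P : Fin n → Submodule R (M ⧸ N) := fun i => (Ns i).map N.mkQ
  have hP (i : Fin n) : InfIrred (P i) := (huni i).infIrred_of_quotient.map_mkQ (hNle i)
  have hPbot : ⨅ i, P i = ⊥ := (iInf_map_mkQ_eq_bot_iff hNle).2 hdec
  constructor
  · obtain ⟨V, hV, hVind, -⟩ := hshort
    have hVne (i : Fin n) : V i ≠ ⊥ := (Submodule.nontrivial_iff_ne_bot).1 (hV i).1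
    let U : Fin n → Submodule R (M ⧸ N) := fun i => ⨅ j ∈ Finset.univ.erase i, P j
    have hUne (i : Fin n) : U i ≠ ⊥ :=
      iInf_ne_bot_of_card_lt hP _
        (by simpa using Finset.card_erase_lt_of_mem (Finset.mem_univ i)) hVne hVind
    have hUnt (i : Fin n) : Nontrivial (U i) := Submodule.nontrivial_iff_ne_bot.2 (hUne i)
    have hUP (i j : Fin n) (hji : j ≠ i) : U j ≤ P i := iInf₂_le i (by simpa using hji.symm)
    have hUPi (i : Fin n) : Disjoint (U i) (P i) := by
      rw [disjoint_iff_inf_le, ← hPbot]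
      refine le_iInf fun j => ?_
      obtain rfl | hij := eq_or_ne i j
      · exact inf_le_right
      · exact inf_le_left.trans (hUP j i hij)
    have hinj (i : Fin n) := injective_mapQ_comp_subtype (hNle i) (hUPi i)
    choose C hPC hC using fun i => exists_isComplementTo (hUPi i)
    exact ⟨U, fun i => (huni i).of_injective _ (hinj i),
      fun i => (hUPi i).mono_right (iSup₂_le (hUP i)),
      fun i => (huni i).leftAss_eq_singleton _ (hinj i), C,
      fun i => ⟨fun j hj => (hUP i j hj).trans (hPC i), hC i, iSup₂_le (hUP i), hPC i⟩⟩
  · intro U hU hUind C hC N' hNN' _ hN'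
    have hdisj := disjoint_iInf_iSup (P := fun i => (N' i).map N.mkQ)
      (fun i => (disjoint_iff.2 (hC i).2.1).mono_right (hN' i).2)
      (fun i j hj => (le_iSup₂_of_le j hj le_rfl).trans (hN' i).1)
    refine (iInf_map_mkQ_eq_bot_iff hNN').1 ?_
    by_contra hK
    refine iInf_ne_bot_of_card_lt hP Finset.univ (n := n + 1) (by simp) (fun i => ?_)
      (iSupIndep_fin_cons hUind hdisj) (by simpa using hPbot)
    induction i using Fin.cases with
    | zero => exact hK
    | succ i => exact Submodule.nontrivial_iff_ne_bot.1 (hU i).1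
end
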